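/- arXiv:2604.23410 — 3 statements merged into one kernel-verified Lean document; each statement's English description precedes it below -/
import Mathlib

section
/- Let m ≥ 2 be an integer and let u, v : (0,∞) → ℝ be differentiable functions with u(r) > 0 and v(r) > 0 for all r > 0, satisfying the Calabi-ansatz system v'(r) = 2 r u(r) and u(r) · v(r)^{m−1} = 2 for all r > 0. Then there exists ε ∈ ℝ such that for all r > 0 one has v(r) = (2m(r² + ε))^{1/m} and u(r) = 2 · (2m(r² + ε))^{−(m−1)/m}. -/
/-- **The general solution of the Calabi-ansatz ODE system** (equations (2.13)–(2.14)
of the paper). Let `m ≥ 2` and let `u, v : (0,∞) → ℝ` be differentiable positive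
functions satisfying `v' = 2 r u` and `u vᵐ⁻¹ = 2`. Then there is `ε ∈ ℝ` with
`v(r) = (2m(r² + ε))^{1/m}` and `u(r) = 2 (2m(r² + ε))^{-(m-1)/m}`. -/
theorem calabi_ansatz_ode_solution
    (m : ℕ) (hm : 2 ≤ m) (u v : ℝ → ℝ)
    (hu_pos : ∀ r : ℝ, 0 < r → 0 < u r)
    (hv_pos : ∀ r : ℝ, 0 < r → 0 < v r)
    (hu_diff : ∀ r : ℝ, 0 < r → DifferentiableAt ℝ u r)
    (hv_diff : ∀ r : ℝ, 0 < r → DifferentiableAt ℝ v r)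
    (hode : ∀ r : ℝ, 0 < r → deriv v r = 2 * r * u r)
    (halg : ∀ r : ℝ, 0 < r → u r * (v r) ^ (m - 1) = 2) :
    ∃ ε : ℝ, ∀ r : ℝ, 0 < r →
      v r = (2 * m * (r ^ 2 + ε)) ^ ((1 : ℝ) / m) ∧
      u r = 2 * (2 * m * (r ^ 2 + ε)) ^ (-(((m : ℝ) - 1) / m)) := by
  have hm0 : (m : ℝ) ≠ 0 := by positivity
  have hderiv : ∀ r : ℝ, 0 < r →
      HasDerivAt (fun r => v r ^ m - 2 * m * r ^ 2) 0 r := by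
    intro r hr
    have hv : HasDerivAt v (2 * r * u r) r := hode r hr ▸ (hv_diff r hr).hasDerivAt
    refine ((hv.fun_pow m).fun_sub
      ((hasDerivAt_pow 2 r).const_mul (2 * (m : ℝ)))).congr_deriv ?_
    push_cast
    linear_combination (2 * m * r) * halg r hr
  obtain ⟨c, hc⟩ := isOpen_Ioi.exists_is_const_of_deriv_eq_zero
    (isPreconnected_Ioi (a := (0 : ℝ)))
    (fun r hr => (hderiv r hr).differentiableAt.differentiableWithinAt)
    (fun r hr => (hderiv r hr).deriv)
  refine ⟨c / (2 * m), fun r hr => ?_⟩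
  have hv := hv_pos r hr
  have hpow : 2 * m * (r ^ 2 + c / (2 * m)) = v r ^ (m : ℝ) := by
    have := hc r hr
    rw [Real.rpow_natCast]
    field_simp
    linear_combination -this
  rw [hpow, ← Real.rpow_mul hv.le, ← Real.rpow_mul hv.le]
  constructor
  · rw [mul_one_div_cancel hm0, Real.rpow_one]
  · have hexp : (m : ℝ) * -(((m : ℝ) - 1) / m) = -((m - 1 : ℕ) : ℝ) := by
      rw [Nat.cast_sub (by lia)]
      field_simp
      simp
    rw [hexp, Real.rpow_neg hv.le, Real.rpow_natCast, ← div_eq_mul_inv,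
      eq_div_iff (pow_pos hv _).ne']
    exact halg r hr
end

section
/- Let n ≥ 1 and let T : ℂⁿ → ℂⁿ be an ℝ-linear map which commutes with every skew-Hermitian complex matrix acting ℂ-linearly on ℂⁿ, i.e. T(Av) = A(Tv) for all v ∈ ℂⁿ and all A ∈ 𝔲(n). Then there exist a, b ∈ ℝ such that T(v) = (a + b·i) • v for all v ∈ ℂⁿ; that is, the commutant of 𝔲(n) in End_ℝ(ℂⁿ) consists precisely of the complex scalar multiples of the identity. -/
open Matrix

/-- Every square complex matrix is a skew-Hermitian matrix plus a product of two
skew-Hermitian matrices. -/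
theorem Matrix.exists_eq_add_mul_of_skewHermitian {ι : Type*} [Fintype ι] [DecidableEq ι]
    (M : Matrix ι ι ℂ) :
    ∃ A B C : Matrix ι ι ℂ, Aᴴ = -A ∧ Bᴴ = -B ∧ Cᴴ = -C ∧ M = A + B * C := by
  refine ⟨(1 / 2 : ℂ) • (M - Mᴴ), (-Complex.I) • 1, (Complex.I / 2) • (M + Mᴴ), ?_, ?_, ?_, ?_⟩
  · ext i j
    simp
    ring
  · simp [conjTranspose_smul]
  · ext i j
    simp
    ring
  · ext i j
    simp
    linear_combination (M i j + (starRingEnd ℂ) (M j i)) / 2 * Complex.I_mul_I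

/-- An additive map commuting with all skew-Hermitian matrices commutes with all matrices. -/
theorem Matrix.map_mulVec_of_commute_skewHermitian {ι F : Type*} [Fintype ι]
    [FunLike F (ι → ℂ) (ι → ℂ)] [AddMonoidHomClass F (ι → ℂ) (ι → ℂ)] (T : F)
    (hT : ∀ A : Matrix ι ι ℂ, Aᴴ = -A → ∀ v : ι → ℂ, T (A *ᵥ v) = A *ᵥ T v)
    (M : Matrix ι ι ℂ) (v : ι → ℂ) : T (M *ᵥ v) = M *ᵥ T v := by
  classical
  obtain ⟨A, B, C, hA, hB, hC, rfl⟩ := M.exists_eq_add_mul_of_skewHermitian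
  simp only [add_mulVec, ← mulVec_mulVec, map_add, hT A hA, hT B hB, hT C hC]

/-- A map commuting with all square matrices is a scalar multiplication. -/
theorem Matrix.eq_smul_of_commute_mulVec {ι R : Type*} [Fintype ι] [DecidableEq ι] [CommSemiring R]
    (T : (ι → R) → (ι → R)) (hT : ∀ (M : Matrix ι ι R) (v : ι → R), T (M *ᵥ v) = M *ᵥ T v)
    (i : ι) (v : ι → R) : T v = T (Pi.single i 1) i • v := by
  have hv : (vecMulVec v (Pi.single i 1)).col i = v := by
    ext j
    simp [vecMulVec_apply]
  simpa [vecMulVec_mulVec, hv] using hT (vecMulVec v (Pi.single i 1)) (Pi.single i 1)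

/-- **The commutant of `𝔲(n)` in `End_ℝ(ℂⁿ)` consists of the complex scalars** (the key
algebraic step in the proof of Lemma 5.10). If `T : ℂⁿ → ℂⁿ` is an `ℝ`-linear map
commuting with every skew-Hermitian matrix `A` (i.e. `T(Av) = A(Tv)` for all `v`), then
`T` is multiplication by a complex scalar `a + b i`. -/
theorem commutant_of_skewHermitian_is_complex_scalar
    (n : ℕ) (hn : 1 ≤ n) (T : (Fin n → ℂ) →ₗ[ℝ] (Fin n → ℂ))
    (hT : ∀ A : Matrix (Fin n) (Fin n) ℂ, Aᴴ = -A →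
      ∀ v : Fin n → ℂ, T (A.mulVec v) = A.mulVec (T v)) :
    ∃ a b : ℝ, ∀ v : Fin n → ℂ, T v = ((a : ℂ) + (b : ℂ) * Complex.I) • v := by
  let i : Fin n := ⟨0, hn⟩
  refine ⟨(T (Pi.single i 1) i).re, (T (Pi.single i 1) i).im, fun v => ?_⟩
  rw [Complex.re_add_im]
  exact eq_smul_of_commute_mulVec T (map_mulVec_of_commute_skewHermitian T hT) i v
end

section
/- Let n ≥ 1 and let J : ℂⁿ → ℂⁿ be an ℝ-linear map with J ∘ J = −id which commutes with every skew-Hermitian complex matrix acting ℂ-linearly on ℂⁿ, i.e. J(Av) = A(Jv) for all v ∈ ℂⁿ and all A ∈ 𝔲(n). Then either J(v) = i • v for all v, or J(v) = −i • v for all v; i.e. J = ± i·id. -/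
open Matrix

/-- Every square complex matrix is `S + i T` with `S` and `T` skew-Hermitian. -/
theorem Matrix.exists_eq_skewHermitian_add_I_smul {ι : Type*} (A : Matrix ι ι ℂ) :
    ∃ S T : Matrix ι ι ℂ, Sᴴ = -S ∧ Tᴴ = -T ∧ A = S + Complex.I • T := by
  refine ⟨(1 / 2 : ℂ) • (A - Aᴴ), (-(Complex.I / 2)) • (A + Aᴴ), ?_, ?_, ?_⟩
  · ext i j
    simp
    ring
  · ext i j
    simp
    ring
  · ext i j
    simp only [add_apply, smul_apply, sub_apply, smul_eq_mul]
    linear_combination (A i j + Aᴴ i j) / 2 * Complex.I_mul_I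

/-- An additive map commuting with all skew-Hermitian matrices commutes with all matrices. -/
theorem map_mulVec_of_commutes_skewHermitian {ι : Type*} [Fintype ι] [DecidableEq ι]
    (J : (ι → ℂ) →+ (ι → ℂ))
    (hJ : ∀ A : Matrix ι ι ℂ, Aᴴ = -A → ∀ v : ι → ℂ, J (A *ᵥ v) = A *ᵥ J v)
    (A : Matrix ι ι ℂ) (v : ι → ℂ) : J (A *ᵥ v) = A *ᵥ J v := by
  have hI (w : ι → ℂ) : J (Complex.I • w) = Complex.I • J w := by
    have h := hJ (Complex.I • (1 : Matrix ι ι ℂ)) (by simp [conjTranspose_smul]) w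
    simpa only [smul_mulVec, one_mulVec] using h
  obtain ⟨S, T, hS, hT, rfl⟩ := A.exists_eq_skewHermitian_add_I_smul
  simp only [add_mulVec, smul_mulVec, map_add, hI, hJ S hS, hJ T hT]

/-- A map commuting with all matrices is multiplication by a scalar. -/
theorem exists_eq_smul_of_commutes_mulVec {ι R : Type*} [Fintype ι] [Nonempty ι] [CommSemiring R]
    (J : (ι → R) → (ι → R))
    (hJ : ∀ (A : Matrix ι ι R) (v : ι → R), J (A *ᵥ v) = A *ᵥ J v) :
    ∃ c : R, ∀ v, J v = c • v := by
  classical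
  obtain ⟨k⟩ := ‹Nonempty ι›
  refine ⟨J (Pi.single k 1) k, fun v => ?_⟩
  have h := hJ (vecMulVec v (Pi.single k 1)) (Pi.single k 1)
  simpa only [vecMulVec_mulVec, single_one_dotProduct, Pi.single_eq_same, MulOpposite.op_one,
    one_smul, op_smul_eq_smul] using h

/-- **A complex structure commuting with `𝔲(n)` is `± i`** (the concluding step in the
proof of Lemma 5.10). If `J : ℂⁿ → ℂⁿ` is an `ℝ`-linear map with `J ∘ J = −id` which
commutes with every skew-Hermitian matrix `A` (i.e. `J(Av) = A(Jv)` for all `v`), then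
`J = i·id` or `J = −i·id`. -/
theorem complex_structure_commuting_with_skewHermitian
    (n : ℕ) (hn : 1 ≤ n) (J : (Fin n → ℂ) →ₗ[ℝ] (Fin n → ℂ))
    (hJJ : ∀ v : Fin n → ℂ, J (J v) = -v)
    (hJ : ∀ A : Matrix (Fin n) (Fin n) ℂ, Aᴴ = -A →
      ∀ v : Fin n → ℂ, J (A.mulVec v) = A.mulVec (J v)) :
    (∀ v : Fin n → ℂ, J v = Complex.I • v) ∨ (∀ v : Fin n → ℂ, J v = -(Complex.I • v)) := by
  have : Nonempty (Fin n) := ⟨⟨0, hn⟩⟩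
  obtain ⟨c, hc⟩ := exists_eq_smul_of_commutes_mulVec J
    (map_mulVec_of_commutes_skewHermitian J.toAddMonoidHom hJ)
  have hcc : c * c = Complex.I * Complex.I := by
    have h := congrFun (hJJ 1) ⟨0, hn⟩
    simpa [hc] using h
  rcases mul_self_eq_mul_self_iff.mp hcc with rfl | rfl
  · exact Or.inl hc
  · exact Or.inr fun v => by rw [hc, neg_smul]
end
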